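/- arXiv:2511.05788 — 3 statements merged into one kernel-verified Lean document; each statement's English description precedes it below -/
import Mathlib

section
/- Suppose in addition that f is convex and that the initial sublevel set {x ∈ dom ψ : F(x) ≤ F(x^0)} has diameter at most R < ∞. Then for any accuracy ε > 0, every integer K with K ≥ Ū + (p+1) · (2 α H_max R^{p+1} / (p! ε))^{1/p} satisfies F(x^K) − F(x⋆) ≤ ε, where H_max = max{H_0, L_p} and Ū = ⌈log_{(α+1)/2}(H_max/H_0)⌉. -/
open scoped BigOperators RealInnerProductSpace

noncomputable section

/-- The `p`-th order Taylor polynomial `T_p(y; x)` of `f` at `x`, evaluated at `y`. -/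
def taylorPoly {n : ℕ} (p : ℕ) (f : EuclideanSpace ℝ (Fin n) → ℝ)
    (x y : EuclideanSpace ℝ (Fin n)) : ℝ :=
  f x + ∑ ℓ ∈ Finset.Icc 1 p,
    (1 / (Nat.factorial ℓ : ℝ)) * iteratedFDeriv ℝ ℓ f x (fun _ => y - x)

/-- The regularized Taylor polynomial `Ω_p^σ(y; x)`. -/
def omegaReg {n : ℕ} (p : ℕ) (σ : ℝ) (f : EuclideanSpace ℝ (Fin n) → ℝ)
    (x y : EuclideanSpace ℝ (Fin n)) : ℝ :=
  taylorPoly p f x y + σ / (Nat.factorial (p + 1) : ℝ) * ‖y - x‖ ^ (p + 1)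

/-- `H_max = max {H₀, L_p}`. -/
def Hmax (H0 Lp : ℝ) : ℝ := max H0 Lp

/-- `Ū = ⌈log_{(α+1)/2} (H_max / H₀)⌉`. -/
def Ubar (α H0 Lp : ℝ) : ℤ := ⌈Real.logb ((α + 1) / 2) (Hmax H0 Lp / H0)⌉

/-- One-dimensional Taylor bound for a chain of derivatives `G 0, G 1, …, G p` whose last member
is Lipschitz at `0`. -/
theorem abs_sub_taylor_sum_le (p : ℕ) (G : ℕ → ℝ → ℝ) (C : ℝ)
    (hG : ∀ i < p, ∀ t, HasDerivAt (G i) (G (i + 1) t) t)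
    (hC : ∀ t, 0 ≤ t → |G p t - G p 0| ≤ C * t) {t : ℝ} (ht : 0 ≤ t) :
    |G 0 t - ∑ i ∈ Finset.range (p + 1), G i 0 * t ^ i / (Nat.factorial i : ℝ)|
      ≤ C * t ^ (p + 1) / (Nat.factorial (p + 1) : ℝ) := by
  induction p generalizing G t with
  | zero => simpa using hC t ht
  | succ p ih =>
    have hbound : ∀ s, 0 ≤ s → |G 1 s
        - ∑ i ∈ Finset.range (p + 1), G (i + 1) 0 * s ^ i / (Nat.factorial i : ℝ)|
        ≤ C * s ^ (p + 1) / (Nat.factorial (p + 1) : ℝ) := fun s hs =>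
      ih (fun i => G (i + 1)) (fun i hi => hG (i + 1) (by lia)) hC hs
    have hpow : ∀ (i : ℕ) (c s : ℝ), HasDerivAt
        (fun r : ℝ => c * r ^ (i + 1) / (Nat.factorial (i + 1) : ℝ))
        (c * s ^ i / (Nat.factorial i : ℝ)) s := by
      intro i c s
      refine (((hasDerivAt_pow (i + 1) s).const_mul c).div_const
        (Nat.factorial (i + 1) : ℝ)).congr_deriv ?_
      rw [Nat.factorial_succ]
      have : (Nat.factorial i : ℝ) ≠ 0 := by positivity
      push_cast
      field_simp
    have hderiv : ∀ s, HasDerivAt (fun r => G 0 r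
        - ∑ i ∈ Finset.range (p + 2), G i 0 * r ^ i / (Nat.factorial i : ℝ))
        (G 1 s - ∑ i ∈ Finset.range (p + 1), G (i + 1) 0 * s ^ i / (Nat.factorial i : ℝ)) s := by
      intro s
      simp_rw [Finset.sum_range_succ' _ (p + 1)]
      have hsum := HasDerivAt.fun_sum (u := Finset.range (p + 1))
        fun i _ => hpow i (G (i + 1) 0) s
      simpa using (hG 0 (by lia) s).fun_sub (hsum.add_const (G 0 0))
    have key := image_norm_le_of_norm_deriv_right_le_deriv_boundary (a := 0) (b := t)
      (f := fun r => G 0 r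
        - ∑ i ∈ Finset.range (p + 2), G i 0 * r ^ i / (Nat.factorial i : ℝ))
      (fun s _ => (hderiv s).continuousAt.continuousWithinAt)
      (fun s _ => (hderiv s).hasDerivWithinAt)
      (B := fun r => C * r ^ (p + 1 + 1) / (Nat.factorial (p + 1 + 1) : ℝ))
      (by simp [Finset.sum_range_succ' _ (p + 1)]) (fun s => hpow (p + 1) C s)
      (fun s hs => by simpa using hbound s hs.1)
    simpa using key (Set.right_mem_Icc.2 ht)

/-- Taylor's inequality for a function whose `p`-th derivative is Lipschitz. -/
theorem abs_sub_taylorPoly_le {n p : ℕ} {f : EuclideanSpace ℝ (Fin n) → ℝ} {L : ℝ}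
    (hf : ContDiff ℝ p f)
    (hLip : ∀ x y : EuclideanSpace ℝ (Fin n),
      ‖iteratedFDeriv ℝ p f x - iteratedFDeriv ℝ p f y‖ ≤ L * ‖x - y‖)
    (x y : EuclideanSpace ℝ (Fin n)) :
    |f y - taylorPoly p f x y| ≤ L / (Nat.factorial (p + 1) : ℝ) * ‖y - x‖ ^ (p + 1) := by
  set v := y - x with hv
  have hline : ∀ t : ℝ, HasDerivAt (fun s : ℝ => x + s • v) v t := fun t => by
    simpa using ((hasDerivAt_id t).smul_const v).const_add x
  have key := abs_sub_taylor_sum_le p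
    (fun i t => iteratedFDeriv ℝ i f (x + t • v) (fun _ => v)) (L * ‖v‖ ^ (p + 1))
    (fun i hi t => by
      have hd := (hf.differentiable_iteratedFDeriv (m := i) (by exact_mod_cast hi)
        (x + t • v)).hasFDerivAt.comp_hasDerivAt t (hline t)
      have := (ContinuousMultilinearMap.apply ℝ (fun _ : Fin i => EuclideanSpace ℝ (Fin n)) ℝ
        (fun _ => v)).hasFDerivAt.comp_hasDerivAt t hd
      simpa [Function.comp_def, iteratedFDeriv_succ_apply_left, Fin.tail_def] using this)
    (fun t ht => by
      have h := (iteratedFDeriv ℝ p f (x + t • v)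
        - iteratedFDeriv ℝ p f (x + (0 : ℝ) • v)).le_opNorm (fun _ => v)
      have h' := hLip (x + t • v) (x + (0 : ℝ) • v)
      simp only [zero_smul, add_zero, add_sub_cancel_left, norm_smul, Real.norm_eq_abs,
        abs_of_nonneg ht, Finset.prod_const, Finset.card_univ, Fintype.card_fin,
        sub_apply] at h h' ⊢
      calc _ ≤ _ := h
        _ ≤ L * (t * ‖v‖) * ‖v‖ ^ p := by gcongr
        _ = _ := by ring)
    zero_le_one
  rw [Finset.range_eq_Ico, Finset.sum_eq_sum_Ico_succ_bot (by lia), zero_add,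
    Finset.Ico_add_one_right_eq_Icc] at key
  have hy : x + v = y := by simp [hv]
  simp only [one_smul, zero_smul, add_zero, one_pow, mul_one, pow_zero, Nat.factorial_zero,
    Nat.cast_one, div_one, iteratedFDeriv_zero_apply, hy] at key
  rw [taylorPoly, ← hv]
  simpa [div_eq_inv_mul, mul_assoc, mul_comm, mul_left_comm] using key

theorem sub_mul_succ_pow_le {s p : ℕ} (hs : 1 ≤ s) :
    ((s : ℝ) - p) * ((s : ℝ) + 1) ^ p ≤ (s : ℝ) ^ (p + 1) := by
  have hs' : (1 : ℝ) ≤ s := by exact_mod_cast hs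
  have hber := one_add_mul_le_pow (a := -(1 / (s : ℝ)))
    (by rw [neg_le_neg_iff, div_le_iff₀ (by linarith)]; linarith) p
  have h1 : ((s : ℝ) - p) * (s : ℝ) ^ p ≤ s * ((s : ℝ) - 1) ^ p := by
    have hmul := mul_le_mul_of_nonneg_right hber (by positivity : (0 : ℝ) ≤ (s : ℝ) ^ (p + 1))
    have e1 : (1 + (p : ℝ) * -(1 / (s : ℝ))) * (s : ℝ) ^ (p + 1)
        = ((s : ℝ) - p) * (s : ℝ) ^ p := by
      field_simp
      ring
    have e2 : (1 + -(1 / (s : ℝ))) ^ p * (s : ℝ) ^ (p + 1) = s * ((s : ℝ) - 1) ^ p := by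
      rw [pow_succ, ← mul_assoc, ← mul_pow, mul_comm]
      congr 2
      field_simp
      ring
    rwa [e1, e2] at hmul
  have h2 : (((s : ℝ) - 1) * ((s : ℝ) + 1)) ^ p ≤ ((s : ℝ) ^ 2) ^ p :=
    pow_le_pow_left₀ (mul_nonneg (by linarith) (by linarith)) (by nlinarith) p
  have hpos : (0 : ℝ) < (s : ℝ) ^ p := by positivity
  refine le_of_mul_le_mul_right ?_ hpos
  calc ((s : ℝ) - p) * ((s : ℝ) + 1) ^ p * (s : ℝ) ^ p
      = ((s : ℝ) - p) * (s : ℝ) ^ p * ((s : ℝ) + 1) ^ p := by ring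
    _ ≤ s * ((s : ℝ) - 1) ^ p * ((s : ℝ) + 1) ^ p := by gcongr
    _ = s * (((s : ℝ) - 1) * ((s : ℝ) + 1)) ^ p := by rw [mul_pow]; ring
    _ ≤ s * ((s : ℝ) ^ 2) ^ p := by gcongr
    _ = (s : ℝ) ^ (p + 1) * (s : ℝ) ^ p := by ring

/-- The inductive step for the rate `δ = O(s ^ (-p))` of a sequence contracting by
`δ' ≤ (1 - θ) δ + B θ ^ (p + 1)`. -/
theorem mul_succ_pow_le_of_contraction {p s : ℕ} (hp : 1 ≤ p) {δ δ' B : ℝ} (hB : 0 ≤ B)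
    (hδ : δ * (s : ℝ) ^ p ≤ B * ((p : ℝ) + 1) ^ (p + 1)) (hδ0 : 0 ≤ δ)
    (hstep : ∀ θ : ℝ, 0 ≤ θ → θ ≤ 1 → δ' ≤ (1 - θ) * δ + B * θ ^ (p + 1)) :
    δ' * ((s + 1 : ℕ) : ℝ) ^ p ≤ B * ((p : ℝ) + 1) ^ (p + 1) := by
  push_cast
  rcases lt_or_ge s p with hsp | hps
  · have h1 : δ' ≤ B := by simpa using hstep 1 zero_le_one le_rfl
    have hsp' : (s : ℝ) + 1 ≤ p := by exact_mod_cast hsp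
    calc δ' * ((s : ℝ) + 1) ^ p ≤ B * ((s : ℝ) + 1) ^ p := by gcongr
      _ ≤ B * ((p : ℝ) + 1) ^ p := by gcongr
      _ ≤ B * ((p : ℝ) + 1) ^ (p + 1) := by
        gcongr
        · linarith
        · lia
  · have hps' : (p : ℝ) ≤ s := by exact_mod_cast hps
    have hs0 : (0 : ℝ) < (s : ℝ) + 1 := by positivity
    have h1 := hstep (((p : ℝ) + 1) / ((s : ℝ) + 1)) (by positivity)
      (by rw [div_le_one hs0]; linarith)
    have h2 := sub_mul_succ_pow_le (p := p) (hp.trans hps)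
    refine le_of_mul_le_mul_right ?_ hs0
    calc δ' * ((s : ℝ) + 1) ^ p * ((s : ℝ) + 1)
        = δ' * ((s : ℝ) + 1) ^ (p + 1) := by ring
      _ ≤ ((1 - ((p : ℝ) + 1) / ((s : ℝ) + 1)) * δ
          + B * (((p : ℝ) + 1) / ((s : ℝ) + 1)) ^ (p + 1)) * ((s : ℝ) + 1) ^ (p + 1) := by
        gcongr
      _ = (((s : ℝ) - p) * ((s : ℝ) + 1) ^ p) * δ + B * ((p : ℝ) + 1) ^ (p + 1) := by
        rw [div_pow]
        field_simp
        ring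
      _ ≤ (s : ℝ) ^ (p + 1) * δ + B * ((p : ℝ) + 1) ^ (p + 1) := by gcongr
      _ = δ * (s : ℝ) ^ p * s + B * ((p : ℝ) + 1) ^ (p + 1) := by ring
      _ ≤ B * ((p : ℝ) + 1) ^ (p + 1) * s + B * ((p : ℝ) + 1) ^ (p + 1) := by gcongr
      _ = B * ((p : ℝ) + 1) ^ (p + 1) * ((s : ℝ) + 1) := by ring

/-- Contraction of the optimality gap after minimizing an upper model `Ω + ψ` of the objective. -/
theorem gap_le_of_model_minimizer {n p : ℕ} {f ψ : EuclideanSpace ℝ (Fin n) → ℝ} {L σ R : ℝ}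
    {domψ : Set (EuclideanSpace ℝ (Fin n))} {x y xstar : EuclideanSpace ℝ (Fin n)}
    (htaylor : ∀ z, |f z - taylorPoly p f x z|
      ≤ L / (Nat.factorial (p + 1) : ℝ) * ‖z - x‖ ^ (p + 1))
    (hfconv : ConvexOn ℝ Set.univ f) (hψconv : ConvexOn ℝ domψ ψ)
    (hx : x ∈ domψ) (hstar : xstar ∈ domψ) (hR : ‖xstar - x‖ ≤ R) (hLσ : 0 ≤ L + σ)
    (hmin : ∀ z ∈ domψ, omegaReg p σ f x y + ψ y ≤ omegaReg p σ f x z + ψ z)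
    (hup : f y ≤ omegaReg p σ f x y) {θ : ℝ} (hθ0 : 0 ≤ θ) (hθ1 : θ ≤ 1) :
    f y + ψ y - (f xstar + ψ xstar) ≤ (1 - θ) * (f x + ψ x - (f xstar + ψ xstar))
      + (L + σ) * R ^ (p + 1) / (Nat.factorial (p + 1) : ℝ) * θ ^ (p + 1) := by
  set z := (1 - θ) • x + θ • xstar with hz
  have hθ' : 0 ≤ 1 - θ := by linarith
  have hsum : 1 - θ + θ = 1 := by ring
  have hfz := hfconv.2 (Set.mem_univ x) (Set.mem_univ xstar) hθ' hθ0 hsum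
  have hψz := hψconv.2 hx hstar hθ' hθ0 hsum
  rw [← hz, smul_eq_mul, smul_eq_mul] at hfz hψz
  have hmz := hmin z (hψconv.1 hx hstar hθ' hθ0 hsum)
  have hTz := (abs_le.1 (htaylor z)).1
  have hnorm : ‖z - x‖ ≤ θ * R := by
    have : z - x = θ • (xstar - x) := by rw [hz]; module
    rw [this, norm_smul, Real.norm_of_nonneg hθ0]
    gcongr
  have hpow : (L + σ) / (Nat.factorial (p + 1) : ℝ) * ‖z - x‖ ^ (p + 1)
      ≤ (L + σ) / (Nat.factorial (p + 1) : ℝ) * (θ * R) ^ (p + 1) := by gcongr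
  rw [mul_pow] at hpow
  have homega : omegaReg p σ f x z
      ≤ f z + (L + σ) / (Nat.factorial (p + 1) : ℝ) * ‖z - x‖ ^ (p + 1) := by
    rw [omegaReg, add_div, add_mul]
    linarith
  have e : (L + σ) * R ^ (p + 1) / (Nat.factorial (p + 1) : ℝ) * θ ^ (p + 1)
      = (L + σ) / (Nat.factorial (p + 1) : ℝ) * (θ ^ (p + 1) * R ^ (p + 1)) := by ring
  rw [e]
  linarith

theorem HAR_convex_complexity
    {n : ℕ} (p : ℕ) (hp : 1 ≤ p)
    (f : EuclideanSpace ℝ (Fin n) → ℝ) (Lp : ℝ)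
    (hf : ContDiff ℝ p f)
    (hLip : ∀ x y : EuclideanSpace ℝ (Fin n),
      ‖iteratedFDeriv ℝ p f x - iteratedFDeriv ℝ p f y‖ ≤ Lp * ‖x - y‖)
    (domψ : Set (EuclideanSpace ℝ (Fin n))) (ψ : EuclideanSpace ℝ (Fin n) → ℝ)
    (hdom_ne : domψ.Nonempty) (hdom_closed : IsClosed domψ) (hdom_conv : Convex ℝ domψ)
    (hψconv : ConvexOn ℝ domψ ψ) (hψlsc : LowerSemicontinuousOn ψ domψ)
    (xstar : EuclideanSpace ℝ (Fin n)) (hstar : xstar ∈ domψ)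
    (hminF : ∀ z ∈ domψ, f xstar + ψ xstar ≤ f z + ψ z)
    (α : ℝ) (hα : 1 < α)
    (x d : ℕ → EuclideanSpace ℝ (Fin n)) (H M : ℕ → ℝ)
    (hx0 : x 0 ∈ domψ) (hH0 : 0 < H 0) (hM0 : M 0 = H 0)
    (hM : ∀ k, 1 ≤ k → M k = max (M (k - 1)) (H (k - 1)))
    (hdmem : ∀ k, 1 ≤ k → x (k - 1) + d k ∈ domψ)
    (hdmin : ∀ k, 1 ≤ k → ∀ z ∈ domψ,
      omegaReg p (α * M k) f (x (k - 1)) (x (k - 1) + d k) + ψ (x (k - 1) + d k)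
        ≤ omegaReg p (α * M k) f (x (k - 1)) z + ψ z)
    (hdne : ∀ k, 1 ≤ k → d k ≠ 0)
    (hxk : ∀ k, 1 ≤ k →
      x k = if f (x (k - 1) + d k) + ψ (x (k - 1) + d k) ≤ f (x (k - 1)) + ψ (x (k - 1))
            then x (k - 1) + d k else x (k - 1))
    (hHk : ∀ k, 1 ≤ k → H k / (Nat.factorial (p + 1) : ℝ)
      = (f (x (k - 1) + d k) - taylorPoly p f (x (k - 1)) (x (k - 1) + d k)) / ‖d k‖ ^ (p + 1))
    (hfconv : ConvexOn ℝ Set.univ f) (R : ℝ)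
    (hR : ∀ z ∈ domψ, f z + ψ z ≤ f (x 0) + ψ (x 0) →
      ∀ w ∈ domψ, f w + ψ w ≤ f (x 0) + ψ (x 0) → ‖z - w‖ ≤ R)
    (ε : ℝ) (hε : 0 < ε) (K : ℕ)
    (hK : (Ubar α (H 0) Lp : ℝ)
        + ((p : ℝ) + 1)
          * (2 * α * Hmax (H 0) Lp * R ^ (p + 1) / ((Nat.factorial p : ℝ) * ε)) ^ ((1 : ℝ) / (p : ℝ))
      ≤ (K : ℝ)) :
    f (x K) + ψ (x K) - (f xstar + ψ xstar) ≤ ε := by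
  set F : EuclideanSpace ℝ (Fin n) → ℝ := fun z => f z + ψ z with hF
  set L := Hmax (H 0) Lp with hL
  set β := (α + 1) / 2 with hβ
  have hLpL : Lp ≤ L := le_max_right _ _
  have hH0L : H 0 ≤ L := le_max_left _ _
  have hLpos : 0 < L := hH0.trans_le hH0L
  have hβ1 : 1 < β := by rw [hβ]; linarith
  have hfact : (0 : ℝ) < (Nat.factorial (p + 1) : ℝ) := by positivity
  have htaylor := abs_sub_taylorPoly_le hf (L := L)
    fun x y => (hLip x y).trans (by gcongr)
  have hHL : ∀ k, H k ≤ L := by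
    intro k
    rcases Nat.eq_zero_or_pos k with rfl | hk
    · exact hH0L
    have hd : 0 < ‖d k‖ ^ (p + 1) := pow_pos (norm_pos_iff.2 (hdne k hk)) _
    have h := (le_abs_self _).trans (htaylor (x (k - 1)) (x (k - 1) + d k))
    rw [add_sub_cancel_left, ← div_le_iff₀ hd, ← hHk k hk] at h
    exact (div_le_div_iff_of_pos_right hfact).1 h
  have hMbound : ∀ k, 0 < M k ∧ M k ≤ L := by
    intro k
    induction k with
    | zero => rw [hM0]; exact ⟨hH0, hH0L⟩
    | succ k ih =>
      rw [hM (k + 1) (by lia), Nat.add_sub_cancel]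
      exact ⟨ih.1.trans_le (le_max_left _ _), max_le ih.2 (hHL k)⟩
  have hR0 : 0 ≤ R := (norm_nonneg _).trans (hR _ hx0 le_rfl _ hx0 le_rfl)
  set B := 2 * α * L * R ^ (p + 1) / (Nat.factorial (p + 1) : ℝ) with hB
  have hB0 : 0 ≤ B := by positivity
  have hmain : ∀ k, (x k ∈ domψ ∧ F (x k) ≤ F (x 0)) ∧ ∃ s u : ℕ, s + u = k
      ∧ β ^ u * H 0 ≤ M (k + 1)
      ∧ (F (x k) - F xstar) * (s : ℝ) ^ p ≤ B * ((p : ℝ) + 1) ^ (p + 1) := by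
    intro k
    induction k with
    | zero =>
      refine ⟨⟨hx0, le_rfl⟩, 0, 0, rfl, ?_, ?_⟩
      · simp [hM 1 le_rfl, hM0]
      · simp only [Nat.cast_zero, zero_pow (by lia : p ≠ 0), mul_zero]
        positivity
    | succ k ih =>
      obtain ⟨⟨hxmem, hxF⟩, s, u, hsu, hu, hs⟩ := ih
      have hk : 1 ≤ k + 1 := by lia
      have hmem := hdmem (k + 1) hk
      have hmin := hdmin (k + 1) hk
      have hHk' := hHk (k + 1) hk
      have hdpos : 0 < ‖d (k + 1)‖ ^ (p + 1) := pow_pos (norm_pos_iff.2 (hdne _ hk)) _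
      have hxs := hxk (k + 1) hk
      have hMs := hM (k + 2) (by lia)
      simp only [Nat.add_sub_cancel, show k + 2 - 1 = k + 1 by lia] at hmem hmin hHk' hxs hMs
      set y := x k + d (k + 1) with hy
      have hnew : x (k + 1) ∈ domψ ∧ F (x (k + 1)) ≤ F y ∧ F (x (k + 1)) ≤ F (x k) := by
        rw [hxs]
        split_ifs with h
        · exact ⟨hmem, le_rfl, h⟩
        · exact ⟨hxmem, (not_le.1 h).le, le_rfl⟩
      refine ⟨⟨hnew.1, hnew.2.2.trans hxF⟩, ?_⟩
      obtain ⟨hMpos, hML⟩ := hMbound (k + 1)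
      by_cases hsucc : H (k + 1) ≤ β * M (k + 1)
      · refine ⟨s + 1, u, by lia, hu.trans (hMs ▸ le_max_left _ _), ?_⟩
        refine mul_succ_pow_le_of_contraction hp hB0 hs
          (sub_nonneg.2 (hminF _ hxmem)) fun θ hθ0 hθ1 => ?_
        have hHα : H (k + 1) ≤ α * M (k + 1) :=
          hsucc.trans (by gcongr; rw [hβ]; linarith)
        have hup : f y ≤ omegaReg p (α * M (k + 1)) f (x k) y := by
          rw [eq_div_iff hdpos.ne'] at hHk'
          have : H (k + 1) / (Nat.factorial (p + 1) : ℝ) * ‖d (k + 1)‖ ^ (p + 1)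
              ≤ α * M (k + 1) / (Nat.factorial (p + 1) : ℝ) * ‖d (k + 1)‖ ^ (p + 1) := by
            gcongr
          rw [omegaReg, hy, add_sub_cancel_left, ← hy]
          linarith
        have hgap := gap_le_of_model_minimizer (htaylor (x k)) hfconv hψconv hxmem hstar
          (hR _ hstar (hminF _ hx0) _ hxmem hxF) (by positivity) hmin hup hθ0 hθ1
        have hcoef : (L + α * M (k + 1)) * R ^ (p + 1) / (Nat.factorial (p + 1) : ℝ)
            * θ ^ (p + 1) ≤ B * θ ^ (p + 1) := by
          rw [hB]
          gcongr
          nlinarith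
        have := hnew.2.1
        simp only [hF] at this ⊢
        linarith
      · refine ⟨s, u + 1, by lia, ?_, ?_⟩
        · calc β ^ (u + 1) * H 0 = β * (β ^ u * H 0) := by ring
            _ ≤ β * M (k + 1) := by gcongr
            _ ≤ H (k + 1) := (not_le.1 hsucc).le
            _ ≤ M (k + 1 + 1) := hMs ▸ le_max_right _ _
        · refine le_trans ?_ hs
          gcongr
          exact hnew.2.2
  obtain ⟨⟨hxmem, hxF⟩, s, u, hsu, hu, hs⟩ := hmain K
  set Q := 2 * α * L * R ^ (p + 1) / ((Nat.factorial p : ℝ) * ε) with hQ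
  have hQ0 : 0 ≤ Q := by positivity
  have huU : (u : ℝ) ≤ (Ubar α (H 0) Lp : ℝ) := by
    refine le_trans ?_ (Int.le_ceil _)
    rw [← hβ, Real.le_logb_iff_rpow_le hβ1 (div_pos hLpos hH0), Real.rpow_natCast,
      le_div_iff₀ hH0]
    exact hu.trans (hMbound _).2
  have hsK : (s : ℝ) + u = K := by exact_mod_cast hsu
  have hsQ : ((p : ℝ) + 1) * Q ^ ((1 : ℝ) / (p : ℝ)) ≤ s := by linarith
  rcases Nat.eq_zero_or_pos s with rfl | hspos
  · have hQz : Q = 0 := by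
      by_contra hne
      have : 0 < Q ^ ((1 : ℝ) / (p : ℝ)) :=
        Real.rpow_pos_of_pos (lt_of_le_of_ne hQ0 (Ne.symm hne)) _
      have : 0 < ((p : ℝ) + 1) * Q ^ ((1 : ℝ) / (p : ℝ)) := by positivity
      simp only [Nat.cast_zero] at hsQ
      linarith
    have hRz : R = 0 := by
      by_contra hne
      have : 0 < R := lt_of_le_of_ne hR0 (Ne.symm hne)
      have : 0 < Q := by positivity
      linarith
    have hxx := hR _ hxmem hxF _ hstar (hminF _ hx0)
    rw [hRz, norm_le_zero_iff, sub_eq_zero] at hxx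
    rw [hxx, sub_self]
    exact hε.le
  · have hpow : ((p : ℝ) + 1) ^ p * Q ≤ (s : ℝ) ^ p := by
      have h := pow_le_pow_left₀ (by positivity) hsQ p
      rwa [mul_pow, one_div, Real.rpow_inv_natCast_pow hQ0 (by lia)] at h
    have hBQ : B * ((p : ℝ) + 1) ^ (p + 1) = ε * (((p : ℝ) + 1) ^ p * Q) := by
      rw [hB, hQ, Nat.factorial_succ]
      push_cast
      field_simp
      ring
    refine le_of_mul_le_mul_right (a := (s : ℝ) ^ p) ?_ (by positivity)
    calc _ ≤ _ := hs
      _ = ε * (((p : ℝ) + 1) ^ p * Q) := hBQ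
      _ ≤ ε * (s : ℝ) ^ p := by gcongr
end
end

section
/- Consider the HAR method run on F = f + ψ, and let ε_g > 0. If the integer K satisfies K − Ū ≥ (2(p+1)! (F(x^0) − F(x⋆)) / ((α−1) H_0)) · (2 α H_max / (p! ε_g))^{(p+1)/p}, then there exists an index k ≤ K and a subgradient u of ψ at x^k such that ‖∇f(x^k) + u‖ ≤ ε_g, i.e. dist(0, ∂F(x^k)) ≤ ε_g. If moreover ψ ≡ 0, p ≥ 2, ε_H > 0, and K also satisfies K − Ū ≥ (2(p+1)! (F(x^0) − F(x⋆)) / ((α−1) H_0)) · (2 α H_max / ((p−1)! ε_H))^{(p+1)/(p−1)}, then the same index k additionally satisfies ⟨∇²f(x^k) h, h⟩ ≥ −ε_H ‖h‖² for all h ∈ ℝ^n. Here H_max = max{H_0, L_p} and Ū = ⌈log_{(α+1)/2}(H_max/H_0)⌉. -/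
open scoped BigOperators RealInnerProductSpace

noncomputable section

section Taylor

universe v

variable {E : Type v} [NormedAddCommGroup E] [NormedSpace ℝ E]

/-- The `q`-th order Taylor polynomial of `g` at `x`, as a function of the increment `w`. -/
def taylorSum {G : Type v} [NormedAddCommGroup G] [NormedSpace ℝ G] (q : ℕ) (g : E → G)
    (x w : E) : G :=
  ∑ ℓ ∈ Finset.range (q + 1), (1 / (ℓ.factorial : ℝ)) • iteratedFDeriv ℝ ℓ g x (fun _ => w)

/-- The iterated derivatives of the second derivative take values in symmetric bilinear maps. -/
theorem iteratedFDeriv_fderiv_fderiv_symm {G : Type v} [NormedAddCommGroup G] [NormedSpace ℝ G]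
    {m : ℕ} {g : E → G} (hg : ContDiff ℝ (m + 2) g) (x : E) (w : Fin m → E) (a b : E) :
    iteratedFDeriv ℝ m (fderiv ℝ (fderiv ℝ g)) x w a b
      = iteratedFDeriv ℝ m (fderiv ℝ (fderiv ℝ g)) x w b a := by
  have h1 : ContDiff ℝ (m + 1) (fderiv ℝ g) := hg.fderiv_right (by norm_cast)
  have h2 : ContDiff ℝ m (fderiv ℝ (fderiv ℝ g)) := h1.fderiv_right le_rfl
  let e : (E →L[ℝ] E →L[ℝ] G) →L[ℝ] (E →L[ℝ] E →L[ℝ] G) :=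
    (ContinuousLinearMap.flipₗᵢ ℝ E E G).toContinuousLinearEquiv
  have he : e ∘ fderiv ℝ (fderiv ℝ g)
      = fderiv ℝ (fderiv ℝ g) := by
    funext y
    ext a b
    have hs : IsSymmSndFDerivAt ℝ g y :=
      (hg.contDiffAt).isSymmSndFDerivAt (by simp)
    exact hs b a
  have := ContinuousLinearMap.iteratedFDeriv_comp_left (G := E →L[ℝ] E →L[ℝ] G) e
    (h2.contDiffAt (x := x)) (i := m) le_rfl
  have h3 : iteratedFDeriv ℝ m (fderiv ℝ (fderiv ℝ g)) x
      = e.compContinuousMultilinearMap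
        (iteratedFDeriv ℝ m (fderiv ℝ (fderiv ℝ g)) x) := by
    rw [← this]
    congr 1
    exact he.symm
  conv_lhs => rw [h3]
  rfl

theorem hasFDerivAt_iteratedFDeriv_diag {m : ℕ} :
    ∀ {G : Type v} [NormedAddCommGroup G] [NormedSpace ℝ G] {g : E → G},
      ContDiff ℝ (m + 1) g → ∀ x w : E,
      HasFDerivAt (fun w => iteratedFDeriv ℝ (m + 1) g x (fun _ => w))
        (((m : ℝ) + 1) • iteratedFDeriv ℝ m (fderiv ℝ g) x (fun _ => w)) w := by
  induction m with
  | zero =>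
    intro G _ _ g hg x w
    simpa using (fderiv ℝ g x).hasFDerivAt
  | succ m ih =>
    intro G _ _ g hg x w
    have hg' : ContDiff ℝ (m + 2) g := by
      convert hg using 1
      push_cast
      rw [add_assoc, one_add_one_eq_two]
    have h1 : ContDiff ℝ (m + 1) (fderiv ℝ g) := hg'.fderiv_right (by norm_cast)
    have h2 := (ih h1 x w).clm_apply (hasFDerivAt_id w)
    have h3 : (fun w : E => iteratedFDeriv ℝ (m + 1 + 1) g x (fun _ => w))
        = fun w => iteratedFDeriv ℝ (m + 1) (fderiv ℝ g) x (fun _ => w) (id w) := by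
      funext w
      rw [iteratedFDeriv_succ_apply_right]
      rfl
    rw [h3]
    refine h2.congr_fderiv ?_
    ext a
    have h4 := iteratedFDeriv_fderiv_fderiv_symm hg' x (fun _ => w) a w
    have h5 : iteratedFDeriv ℝ (m + 1) (fderiv ℝ g) x (fun _ => w)
        = iteratedFDeriv ℝ m (fderiv ℝ (fderiv ℝ g)) x (fun _ => w) w := by
      rw [iteratedFDeriv_succ_apply_right]
      rfl
    simp [h4, h5, add_smul, add_comm]

theorem hasFDerivAt_taylorSum {G : Type v} [NormedAddCommGroup G] [NormedSpace ℝ G] {q : ℕ}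
    {g : E → G} (hg : ContDiff ℝ (q + 1) g) (x w : E) :
    HasFDerivAt (taylorSum (q + 1) g x) (taylorSum q (fderiv ℝ g) x w) w := by
  have h1 : taylorSum (q + 1) g x = fun w => ∑ ℓ ∈ Finset.range (q + 1),
      (1 / ((ℓ + 1).factorial : ℝ)) • iteratedFDeriv ℝ (ℓ + 1) g x (fun _ => w) + g x := by
    funext w
    simp [taylorSum, Finset.sum_range_succ' _ (q + 1)]
  rw [h1]
  refine HasFDerivAt.add_const _ (HasFDerivAt.fun_sum fun ℓ hℓ => ?_)
  have hℓ' : ℓ ≤ q := by simpa [Nat.lt_succ_iff] using hℓ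
  have h2 : ContDiff ℝ (ℓ + 1) g := hg.of_le (by gcongr)
  refine ((hasFDerivAt_iteratedFDeriv_diag h2 x w).const_smul
    (1 / ((ℓ + 1).factorial : ℝ))).congr_fderiv ?_
  rw [smul_smul]
  congr 1
  rw [Nat.factorial_succ]
  push_cast
  field_simp

theorem norm_iteratedFDeriv_fderiv_sub {G : Type v} [NormedAddCommGroup G] [NormedSpace ℝ G]
    (q : ℕ) (g : E → G) (x y : E) :
    ‖iteratedFDeriv ℝ q (fderiv ℝ g) x - iteratedFDeriv ℝ q (fderiv ℝ g) y‖
      = ‖iteratedFDeriv ℝ (q + 1) g x - iteratedFDeriv ℝ (q + 1) g y‖ := by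
  rw [iteratedFDeriv_succ_eq_comp_right, iteratedFDeriv_succ_eq_comp_right,
    Function.comp_apply, Function.comp_apply, ← dist_eq_norm, ← dist_eq_norm,
    LinearIsometryEquiv.dist_map]

/-- Taylor's theorem with a Lipschitz bound on the highest derivative. -/
theorem norm_sub_taylorSum_le {q : ℕ} :
    ∀ {G : Type v} [NormedAddCommGroup G] [NormedSpace ℝ G] {g : E → G} {L : ℝ},
      ContDiff ℝ q g →
      (∀ x y, ‖iteratedFDeriv ℝ q g x - iteratedFDeriv ℝ q g y‖ ≤ L * ‖x - y‖) → ∀ x w : E,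
      ‖g (x + w) - taylorSum q g x w‖ ≤ L / ((q + 1).factorial : ℝ) * ‖w‖ ^ (q + 1) := by
  induction q with
  | zero =>
    intro G _ _ g L hg hL x w
    have h := hL (x + w) x
    rw [iteratedFDeriv_zero_eq_comp, Function.comp_apply, Function.comp_apply, ← map_sub,
      LinearIsometryEquiv.norm_map] at h
    simpa [taylorSum] using h
  | succ q ih =>
    intro G _ _ g L hg hL x w
    have hg' : ContDiff ℝ (q + 1) g := by exact_mod_cast hg
    have hd : ContDiff ℝ q (fderiv ℝ g) := hg'.fderiv_right le_rfl
    have hih := ih hd (fun x y => (norm_iteratedFDeriv_fderiv_sub q g x y).trans_le (hL x y)) x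
    have hdiff : Differentiable ℝ g := hg'.differentiable (by simp)
    have hder : ∀ t : ℝ, HasDerivAt (fun t : ℝ => g (x + t • w) - taylorSum (q + 1) g x (t • w))
        ((fderiv ℝ g (x + t • w) - taylorSum q (fderiv ℝ g) x (t • w)) w) t := by
      intro t
      have hl : HasDerivAt (fun t : ℝ => t • w) w t := by
        simpa using (hasDerivAt_id t).smul_const w
      have h1 := (hdiff (x + t • w)).hasFDerivAt.comp_hasDerivAt t (hl.const_add x)
      have h2 := (hasFDerivAt_taylorSum hg' x (t • w)).comp_hasDerivAt t hl
      exact h1.sub h2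
    have hB : ∀ t : ℝ, HasDerivAt
        (fun t : ℝ => L / ((q + 1 + 1).factorial : ℝ) * ‖w‖ ^ (q + 1 + 1) * t ^ (q + 1 + 1))
        (L / ((q + 1).factorial : ℝ) * ‖w‖ ^ (q + 1 + 1) * t ^ (q + 1)) t := by
      intro t
      refine ((hasDerivAt_pow (q + 1 + 1) t).const_mul _).congr_deriv ?_
      rw [Nat.factorial_succ (q + 1)]
      push_cast
      field_simp
    have key := image_norm_le_of_norm_deriv_right_le_deriv_boundary (a := 0) (b := 1)
      (fun t _ => (hder t).continuousAt.continuousWithinAt)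
      (fun t _ => (hder t).hasDerivWithinAt) (by
        simp [taylorSum, Finset.sum_range_succ' _ (q + 1), ← Pi.zero_def]) hB (fun t ht => by
        refine (ContinuousLinearMap.le_opNorm _ _).trans ?_
        have h := mul_le_mul_of_nonneg_right (hih (t • w)) (norm_nonneg w)
        rw [norm_smul, Real.norm_of_nonneg ht.1] at h
        refine h.trans_eq ?_
        ring) (Set.right_mem_Icc.2 zero_le_one)
    simpa using key

end Taylor

section RegularizedModel

theorem deriv_nonneg_of_le_on_Icc {g : ℝ → ℝ} {g' : ℝ} (hg : HasDerivAt g g' 0)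
    (h : ∀ t ∈ Set.Icc (0 : ℝ) 1, g 0 ≤ g t) : 0 ≤ g' := by
  have hmin : IsLocalMinOn g (Set.Icc 0 1) 0 := IsMinOn.localize h
  have hcone : (1 : ℝ) ∈ posTangentConeAt (Set.Icc (0 : ℝ) 1) 0 := by
    simpa using sub_mem_posTangentConeAt_of_segment_subset
      (x := (0 : ℝ)) (y := 1) (s := Set.Icc (0 : ℝ) 1) (by rw [segment_eq_Icc zero_le_one])
  simpa using hmin.hasFDerivWithinAt_nonneg hg.hasFDerivAt.hasFDerivWithinAt hcone

theorem second_deriv_nonneg_of_isLocalMin {g g' : ℝ → ℝ} {a g'' : ℝ} (hmin : IsLocalMin g a)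
    (hg : ∀ᶠ t in nhds a, HasDerivAt g (g' t) t) (hg' : HasDerivAt g' g'' a) : 0 ≤ g'' := by
  by_contra! hneg
  have hd : deriv g =ᶠ[nhds a] g' := hg.mono fun t ht => ht.deriv
  have hdd : deriv (deriv g) a = g'' := by rw [hd.deriv_eq, hg'.deriv]
  have hmax : IsLocalMax g a := isLocalMax_of_deriv_deriv_neg (hdd ▸ hneg) hmin.deriv_eq_zero
    hg.self_of_nhds.continuousAt
  have hconst : g =ᶠ[nhds a] fun _ => g a := by
    filter_upwards [hmin, hmax] with t h1 h2 using le_antisymm h2 h1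
  have hzero : deriv g =ᶠ[nhds a] fun _ => 0 := by
    simpa using hconst.deriv
  rw [hzero.deriv_eq, deriv_const] at hdd
  exact hneg.ne' hdd

variable {E : Type} [NormedAddCommGroup E] [InnerProductSpace ℝ E]

theorem hasDerivAt_norm_add_smul {d h : E} {t : ℝ} (hne : d + t • h ≠ 0) :
    HasDerivAt (fun t : ℝ => ‖d + t • h‖) (⟪d + t • h, h⟫ / ‖d + t • h‖) t := by
  have hl : HasDerivAt (fun t : ℝ => d + t • h) h t := by
    simpa using ((hasDerivAt_id t).smul_const h).const_add d
  have h1 := hl.norm_sq.sqrt (by positivity)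
  simp only [Real.sqrt_sq (norm_nonneg _)] at h1
  refine h1.congr_deriv ?_
  rw [mul_div_mul_left _ _ two_ne_zero]

theorem hasDerivAt_norm_add_smul_pow (m : ℕ) {d h : E} {t : ℝ} (hne : d + t • h ≠ 0) :
    HasDerivAt (fun t : ℝ => ‖d + t • h‖ ^ (m + 2))
      (((m : ℝ) + 2) * ‖d + t • h‖ ^ m * ⟪d + t • h, h⟫) t := by
  refine ((hasDerivAt_norm_add_smul hne).fun_pow (m + 2)).congr_deriv ?_
  have : ‖d + t • h‖ ≠ 0 := norm_ne_zero_iff.2 hne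
  push_cast
  rw [pow_succ]
  field_simp

theorem hasDerivAt_regularizedTaylor {q : ℕ} {f : E → ℝ} (hf : ContDiff ℝ (q + 1) f) (σ : ℝ)
    (x : E) {d h : E} {t : ℝ} (hne : d + t • h ≠ 0) :
    HasDerivAt (fun t : ℝ => taylorSum (q + 1) f x (d + t • h)
        + σ / ((q + 2).factorial : ℝ) * ‖d + t • h‖ ^ (q + 2))
      (taylorSum q (fderiv ℝ f) x (d + t • h) h
        + σ / ((q + 1).factorial : ℝ) * (‖d + t • h‖ ^ q * ⟪d + t • h, h⟫)) t := by
  have hl : HasDerivAt (fun t : ℝ => d + t • h) h t := by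
    simpa using ((hasDerivAt_id t).smul_const h).const_add d
  have h1 := (hasFDerivAt_taylorSum hf x (d + t • h)).comp_hasDerivAt t hl
  refine (h1.add ((hasDerivAt_norm_add_smul_pow q hne).const_mul _)).congr_deriv ?_
  rw [Nat.factorial_succ (q + 1)]
  push_cast
  have : (q : ℝ) + 1 + 1 ≠ 0 := by positivity
  field_simp
  ring

/-- First-order optimality of a minimizer of the regularized model plus a convex function. -/
theorem regularizedTaylor_first_order {q : ℕ} {f : E → ℝ} (hf : ContDiff ℝ (q + 1) f) {σ : ℝ}
    {s : Set E} {ψ : E → ℝ} (hψ : ConvexOn ℝ s ψ) {x d : E} (hd : d ≠ 0) (hmem : x + d ∈ s)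
    (hmin : ∀ z ∈ s, taylorSum (q + 1) f x d + σ / ((q + 2).factorial : ℝ) * ‖d‖ ^ (q + 2)
      + ψ (x + d) ≤ taylorSum (q + 1) f x (z - x)
        + σ / ((q + 2).factorial : ℝ) * ‖z - x‖ ^ (q + 2) + ψ z) {z : E} (hz : z ∈ s) :
    ψ (x + d) ≤ ψ z + (taylorSum q (fderiv ℝ f) x d (z - (x + d))
      + σ / ((q + 1).factorial : ℝ) * (‖d‖ ^ q * ⟪d, z - (x + d)⟫)) := by
  have hder := hasDerivAt_regularizedTaylor hf σ x (d := d) (h := z - (x + d)) (t := 0)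
    (by simpa using hd)
  have hlin : HasDerivAt (fun t : ℝ => t * (ψ z - ψ (x + d))) (ψ z - ψ (x + d)) 0 := by
    simpa using (hasDerivAt_id (0 : ℝ)).mul_const (ψ z - ψ (x + d))
  have key := deriv_nonneg_of_le_on_Icc (hder.add hlin) (fun t ht => by
    have hcomb : x + (d + t • (z - (x + d))) = (1 - t) • (x + d) + t • z := by module
    have h1 : x + (d + t • (z - (x + d))) ∈ s := by
      rw [hcomb]
      exact hψ.1 hmem hz (by linarith [ht.2]) ht.1 (by ring)
    have h2 := hmin _ h1
    have h3 := hψ.2 hmem hz (sub_nonneg.2 ht.2) ht.1 (by ring)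
    rw [← hcomb, smul_eq_mul, smul_eq_mul] at h3
    rw [add_sub_cancel_left] at h2
    simp only [Pi.add_apply, zero_smul, add_zero, zero_mul]
    linarith)
  simp only [zero_smul, add_zero] at key
  linarith

/-- Second-order optimality of a minimizer of the regularized model. -/
theorem regularizedTaylor_second_order {m : ℕ} {f : E → ℝ} (hf : ContDiff ℝ (m + 2) f) {σ : ℝ}
    (hσ : 0 ≤ σ) {x d : E} (hd : d ≠ 0)
    (hmin : ∀ w, taylorSum (m + 1 + 1) f x d + σ / ((m + 1 + 2).factorial : ℝ) * ‖d‖ ^ (m + 1 + 2)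
      ≤ taylorSum (m + 1 + 1) f x w
        + σ / ((m + 1 + 2).factorial : ℝ) * ‖w‖ ^ (m + 1 + 2)) (h : E) :
    0 ≤ taylorSum m (fderiv ℝ (fderiv ℝ f)) x d h h
      + σ / ((m + 1).factorial : ℝ) * ‖d‖ ^ (m + 1) * ‖h‖ ^ 2 := by
  have hf' : ContDiff ℝ ((m + 1 : ℕ) + 1) f := by
    convert hf using 1
    push_cast
    rw [add_assoc, one_add_one_eq_two]
  have hdf : ContDiff ℝ (m + 1) (fderiv ℝ f) := hf.fderiv_right (by norm_cast)
  have hl : HasDerivAt (fun t : ℝ => d + t • h) h 0 := by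
    simpa using ((hasDerivAt_id (0 : ℝ)).smul_const h).const_add d
  have hd0 : d + (0 : ℝ) • h ≠ 0 := by simpa using hd
  have hev : ∀ᶠ t in nhds (0 : ℝ), d + t • h ≠ 0 := hl.continuousAt.eventually_ne hd0
  have hT : HasDerivAt (fun t : ℝ => taylorSum (m + 1) (fderiv ℝ f) x (d + t • h) h)
      (taylorSum m (fderiv ℝ (fderiv ℝ f)) x d h h) 0 := by
    have h1 := hasFDerivAt_taylorSum hdf x (d + (0 : ℝ) • h)
    have h2 := h1.comp_hasDerivAt 0 hl
    have h3 := (ContinuousLinearMap.apply ℝ ℝ h).hasFDerivAt.comp_hasDerivAt 0 h2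
    simpa only [zero_smul, add_zero] using! h3
  have hN := (((hasDerivAt_norm_add_smul hd0).fun_pow (m + 1)).mul
    (hl.inner ℝ (hasDerivAt_const (0 : ℝ) h))).const_mul (σ / ((m + 1 + 1).factorial : ℝ))
  have hloc : IsLocalMin (fun t : ℝ => taylorSum (m + 1 + 1) f x (d + t • h)
      + σ / ((m + 1 + 2).factorial : ℝ) * ‖d + t • h‖ ^ (m + 1 + 2)) 0 :=
    Filter.Eventually.of_forall fun t => by
      simpa only [zero_smul, add_zero] using hmin (d + t • h)
  have key := second_deriv_nonneg_of_isLocalMin hloc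
    (hev.mono fun t ht => hasDerivAt_regularizedTaylor hf' σ x ht) (hT.add hN)
  simp only [zero_smul, add_zero, inner_zero_right, zero_add,
    real_inner_self_eq_norm_sq, Nat.add_sub_cancel] at key
  refine key.trans ?_
  have hdpos : 0 < ‖d‖ := norm_pos_iff.2 hd
  have hcs : ⟪d, h⟫ * ⟪d, h⟫ ≤ ‖d‖ ^ 2 * ‖h‖ ^ 2 := by
    rw [← mul_pow, ← sq]
    exact sq_le_sq' (by linarith [neg_le_of_abs_le (abs_real_inner_le_norm d h)])
      (real_inner_le_norm d h)
  have hterm : ((m + 1 : ℕ) : ℝ) * ‖d‖ ^ m * (⟪d, h⟫ / ‖d‖) * ⟪d, h⟫ + ‖d‖ ^ (m + 1) * ‖h‖ ^ 2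
      ≤ ((m : ℝ) + 2) * (‖d‖ ^ (m + 1) * ‖h‖ ^ 2) := by
    have : ((m + 1 : ℕ) : ℝ) * ‖d‖ ^ m * (⟪d, h⟫ / ‖d‖) * ⟪d, h⟫
        ≤ ((m + 1 : ℕ) : ℝ) * (‖d‖ ^ (m + 1) * ‖h‖ ^ 2) := by
      calc ((m + 1 : ℕ) : ℝ) * ‖d‖ ^ m * (⟪d, h⟫ / ‖d‖) * ⟪d, h⟫
          = ((m + 1 : ℕ) : ℝ) * ‖d‖ ^ m / ‖d‖ * (⟪d, h⟫ * ⟪d, h⟫) := by ring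
        _ ≤ ((m + 1 : ℕ) : ℝ) * ‖d‖ ^ m / ‖d‖ * (‖d‖ ^ 2 * ‖h‖ ^ 2) := by gcongr
        _ = ((m + 1 : ℕ) : ℝ) * (‖d‖ ^ (m + 1) * ‖h‖ ^ 2) := by
          field_simp
          ring
    push_cast at this ⊢
    linarith
  have hscale : σ / ((m + 1 + 1).factorial : ℝ) * (((m : ℝ) + 2) * (‖d‖ ^ (m + 1) * ‖h‖ ^ 2))
      = σ / ((m + 1).factorial : ℝ) * ‖d‖ ^ (m + 1) * ‖h‖ ^ 2 := by
    rw [Nat.factorial_succ (m + 1)]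
    push_cast
    have : (m : ℝ) + 1 + 1 ≠ 0 := by positivity
    field_simp
    ring
  have := mul_le_mul_of_nonneg_left hterm
    (show 0 ≤ σ / ((m + 1 + 1).factorial : ℝ) by positivity)
  rw [hscale] at this
  linarith

end RegularizedModel

section Counting

/-- Steps with `2 * H k > (α + 1) * M k` multiply the running maximum `M` by at least
`(α + 1) / 2`. -/
theorem mul_pow_card_le_of_running_max {M H : ℕ → ℝ} {α : ℝ} (hα : 1 < α) (hM0 : M 0 = H 0)
    (hM : ∀ k, 1 ≤ k → M k = max (M (k - 1)) (H (k - 1))) (N : ℕ) :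
    H 0 * ((α + 1) / 2) ^ ((Finset.Icc 1 N).filter (fun k => ¬ 2 * H k ≤ (α + 1) * M k)).card
      ≤ M (N + 1) := by
  induction N with
  | zero => simp [hM 1 le_rfl, hM0]
  | succ N ih =>
    rw [← Finset.insert_Icc_right_eq_Icc_add_one (by omega : 1 ≤ N + 1), Finset.filter_insert]
    have hMN : M (N + 1 + 1) = max (M (N + 1)) (H (N + 1)) := hM (N + 1 + 1) (by omega)
    split_ifs with h
    · exact ih.trans (hMN ▸ le_max_left _ _)
    · rw [Finset.card_insert_of_notMem (by simp), pow_succ, hMN]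
      refine le_max_of_le_right ?_
      nlinarith

/-- The decreases achieved at the steps satisfying `P` add up to at most the total decrease. -/
theorem sum_filter_le_sub_of_antitone_steps {F r : ℕ → ℝ} {P : ℕ → Prop} [DecidablePred P]
    (hF : ∀ k, F (k + 1) ≤ F k) (hr : ∀ k, P (k + 1) → F (k + 1) + r (k + 1) ≤ F k) (N : ℕ) :
    ∑ k ∈ (Finset.Icc 1 N).filter P, r k ≤ F 0 - F N := by
  induction N with
  | zero => simp
  | succ N ih =>
    rw [← Finset.insert_Icc_right_eq_Icc_add_one (by omega : 1 ≤ N + 1), Finset.filter_insert]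
    split_ifs with h
    · rw [Finset.sum_insert (by simp)]
      linarith [hr N h]
    · linarith [hF N]

theorem pow_mul_le_one_of_rpow {r C s : ℝ} {m : ℕ} (hm : 0 < m) (hr : 0 < r) (hC : 0 < C)
    {N : ℕ} (hN : 0 < N) (hs : s = (N : ℝ) / m) (h : r ^ N * C ^ s ≤ 1) : r ^ m * C ≤ 1 := by
  by_contra! hlt
  have hm' : (0 : ℝ) < m := by exact_mod_cast hm
  have hN' : (0 : ℝ) < N := by exact_mod_cast hN
  have h1 := Real.one_lt_rpow hlt (show 0 < s by rw [hs]; positivity)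
  rw [Real.mul_rpow (by positivity) hC.le, ← Real.rpow_natCast_mul hr.le, hs,
    mul_div_cancel₀ _ hm'.ne', Real.rpow_natCast, ← hs] at h1
  exact h1.not_ge h

end Counting

theorem taylorPoly_eq_taylorSum {n : ℕ} (p : ℕ) (f : EuclideanSpace ℝ (Fin n) → ℝ)
    (x y : EuclideanSpace ℝ (Fin n)) : taylorPoly p f x y = taylorSum p f x (y - x) := by
  rw [taylorPoly, taylorSum, Finset.range_eq_Ico, Finset.sum_eq_sum_Ico_succ_bot (by omega)]
  simp [Finset.Ico_add_one_right_eq_Icc]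

theorem omegaReg_eq {n : ℕ} (p : ℕ) (σ : ℝ) (f : EuclideanSpace ℝ (Fin n) → ℝ)
    (x y : EuclideanSpace ℝ (Fin n)) :
    omegaReg p σ f x y
      = taylorSum p f x (y - x) + σ / ((p + 1).factorial : ℝ) * ‖y - x‖ ^ (p + 1) := by
  rw [omegaReg, taylorPoly_eq_taylorSum]

theorem omegaReg_self {n : ℕ} (p : ℕ) (σ : ℝ) (f : EuclideanSpace ℝ (Fin n) → ℝ)
    (x : EuclideanSpace ℝ (Fin n)) : omegaReg p σ f x x = f x := by
  have : ∀ ℓ ∈ Finset.Icc 1 p, (1 / (ℓ.factorial : ℝ)) *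
      iteratedFDeriv ℝ ℓ f x (fun _ => x - x) = 0 := by
    intro ℓ hℓ
    have : Nonempty (Fin ℓ) := ⟨⟨0, (Finset.mem_Icc.1 hℓ).1⟩⟩
    rw [sub_self, (iteratedFDeriv ℝ ℓ f x).map_coord_zero (Classical.arbitrary _) rfl, mul_zero]
  rw [omegaReg, taylorPoly, Finset.sum_eq_zero this]
  simp

/-- The endpoint of a regularized step is stationary up to an error proportional to the
`(q + 1)`-st power of the step length. -/
theorem exists_subgradient_of_regularized_step {n q : ℕ} {f : EuclideanSpace ℝ (Fin n) → ℝ}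
    (hf : ContDiff ℝ (q + 1 : ℕ) f) {L : ℝ}
    (hLip : ∀ x y, ‖iteratedFDeriv ℝ (q + 1) f x - iteratedFDeriv ℝ (q + 1) f y‖ ≤ L * ‖x - y‖)
    {σ : ℝ} (hσ : 0 ≤ σ) {s : Set (EuclideanSpace ℝ (Fin n))} {ψ : EuclideanSpace ℝ (Fin n) → ℝ}
    (hψ : ConvexOn ℝ s ψ) {x d : EuclideanSpace ℝ (Fin n)} (hd : d ≠ 0) (hmem : x + d ∈ s)
    (hmin : ∀ z ∈ s, omegaReg (q + 1) σ f x (x + d) + ψ (x + d)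
      ≤ omegaReg (q + 1) σ f x z + ψ z) :
    ∃ u : EuclideanSpace ℝ (Fin n), (∀ z ∈ s, ψ (x + d) + ⟪u, z - (x + d)⟫ ≤ ψ z) ∧
      ‖gradient f (x + d) + u‖ ≤ (L + σ) / ((q + 1).factorial : ℝ) * ‖d‖ ^ (q + 1) := by
  have hf' : ContDiff ℝ (q + 1) f := by exact_mod_cast hf
  have hdf : ContDiff ℝ q (fderiv ℝ f) := hf'.fderiv_right le_rfl
  set D := taylorSum q (fderiv ℝ f) x d with hD
  set c := σ / ((q + 1).factorial : ℝ) * ‖d‖ ^ q with hc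
  have hc0 : 0 ≤ c := by positivity
  refine ⟨-((InnerProductSpace.toDual ℝ _).symm D + c • d), fun z hz => ?_, ?_⟩
  · have h := regularizedTaylor_first_order hf' (σ := σ) hψ hd hmem (fun z hz => by
      simpa only [omegaReg_eq, add_sub_cancel_left] using hmin z hz) hz
    rw [inner_neg_left, inner_add_left, InnerProductSpace.toDual_symm_apply, inner_smul_left]
    simp only [conj_trivial]
    rw [← hD, ← mul_assoc, ← hc] at h
    linarith
  · have hrem := norm_sub_taylorSum_le hdf
      (fun x y => (norm_iteratedFDeriv_fderiv_sub q f x y).trans_le (hLip x y)) x d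
    have heq : gradient f (x + d) + -((InnerProductSpace.toDual ℝ _).symm D + c • d)
        = (InnerProductSpace.toDual ℝ (EuclideanSpace ℝ (Fin n))).symm (fderiv ℝ f (x + d) - D)
          - c • d := by
      rw [map_sub, gradient]
      abel
    rw [heq]
    refine (norm_sub_le _ _).trans ?_
    rw [LinearIsometryEquiv.norm_map, norm_smul, Real.norm_of_nonneg hc0]
    refine (add_le_add_left hrem _).trans_eq ?_
    rw [hc]
    ring

/-- Second-order counterpart of `exists_subgradient_of_regularized_step` without the convex
term. -/
theorem neg_le_second_deriv_of_regularized_step {n m : ℕ} {f : EuclideanSpace ℝ (Fin n) → ℝ}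
    (hf : ContDiff ℝ (m + 1 + 1 : ℕ) f) {L : ℝ}
    (hLip : ∀ x y,
      ‖iteratedFDeriv ℝ (m + 1 + 1) f x - iteratedFDeriv ℝ (m + 1 + 1) f y‖ ≤ L * ‖x - y‖)
    {σ : ℝ} (hσ : 0 ≤ σ) {x d : EuclideanSpace ℝ (Fin n)} (hd : d ≠ 0)
    (hmin : ∀ z, omegaReg (m + 1 + 1) σ f x (x + d) ≤ omegaReg (m + 1 + 1) σ f x z)
    (h : EuclideanSpace ℝ (Fin n)) :
    -((L + σ) / ((m + 1).factorial : ℝ) * ‖d‖ ^ (m + 1) * ‖h‖ ^ 2)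
      ≤ iteratedFDeriv ℝ 2 f (x + d) (fun _ => h) := by
  have hf' : ContDiff ℝ (m + 2) f := by
    convert hf using 1
    push_cast
    rw [add_assoc, one_add_one_eq_two]
  have hdf : ContDiff ℝ (m + 1) (fderiv ℝ f) := hf'.fderiv_right (by norm_cast)
  have hddf : ContDiff ℝ m (fderiv ℝ (fderiv ℝ f)) := hdf.fderiv_right le_rfl
  have h2 := regularizedTaylor_second_order hf' hσ hd (fun w => by
    simpa only [omegaReg_eq, add_sub_cancel_left] using hmin (x + w)) h
  have hrem := norm_sub_taylorSum_le hddf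
    (fun x y => (norm_iteratedFDeriv_fderiv_sub m (fderiv ℝ f) x y).trans_le
      ((norm_iteratedFDeriv_fderiv_sub (m + 1) f x y).trans_le (hLip x y))) x d
  have hop := (fderiv ℝ (fderiv ℝ f) (x + d)
    - taylorSum m (fderiv ℝ (fderiv ℝ f)) x d).le_opNorm₂ h h
  have hle := mul_le_mul_of_nonneg_right hrem (sq_nonneg ‖h‖)
  rw [mul_assoc, ← sq] at hop
  have habs := neg_le_of_abs_le (hop.trans hle)
  rw [iteratedFDeriv_two_apply]
  simp only [sub_apply] at habs
  rw [add_div, add_mul, add_mul]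
  linarith

theorem HAR_nonconvex_complexity
    {n : ℕ} (p : ℕ) (hp : 1 ≤ p)
    (f : EuclideanSpace ℝ (Fin n) → ℝ) (Lp : ℝ)
    (hf : ContDiff ℝ p f)
    (hLip : ∀ x y : EuclideanSpace ℝ (Fin n),
      ‖iteratedFDeriv ℝ p f x - iteratedFDeriv ℝ p f y‖ ≤ Lp * ‖x - y‖)
    (domψ : Set (EuclideanSpace ℝ (Fin n))) (ψ : EuclideanSpace ℝ (Fin n) → ℝ)
    (hdom_ne : domψ.Nonempty) (hdom_closed : IsClosed domψ) (hdom_conv : Convex ℝ domψ)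
    (hψconv : ConvexOn ℝ domψ ψ) (hψlsc : LowerSemicontinuousOn ψ domψ)
    (xstar : EuclideanSpace ℝ (Fin n)) (hstar : xstar ∈ domψ)
    (hminF : ∀ z ∈ domψ, f xstar + ψ xstar ≤ f z + ψ z)
    (α : ℝ) (hα : 1 < α)
    (x d : ℕ → EuclideanSpace ℝ (Fin n)) (H M : ℕ → ℝ)
    (hx0 : x 0 ∈ domψ) (hH0 : 0 < H 0) (hM0 : M 0 = H 0)
    (hM : ∀ k, 1 ≤ k → M k = max (M (k - 1)) (H (k - 1)))
    (hdmem : ∀ k, 1 ≤ k → x (k - 1) + d k ∈ domψ)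
    (hdmin : ∀ k, 1 ≤ k → ∀ z ∈ domψ,
      omegaReg p (α * M k) f (x (k - 1)) (x (k - 1) + d k) + ψ (x (k - 1) + d k)
        ≤ omegaReg p (α * M k) f (x (k - 1)) z + ψ z)
    (hdne : ∀ k, 1 ≤ k → d k ≠ 0)
    (hxk : ∀ k, 1 ≤ k →
      x k = if f (x (k - 1) + d k) + ψ (x (k - 1) + d k) ≤ f (x (k - 1)) + ψ (x (k - 1))
            then x (k - 1) + d k else x (k - 1))
    (hHk : ∀ k, 1 ≤ k → H k / (Nat.factorial (p + 1) : ℝ)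
      = (f (x (k - 1) + d k) - taylorPoly p f (x (k - 1)) (x (k - 1) + d k)) / ‖d k‖ ^ (p + 1))
    (K : ℕ) (εg εH : ℝ) (hεg : 0 < εg) (hεH : 0 < εH)
    (hK : (2 * (Nat.factorial (p + 1) : ℝ) * ((f (x 0) + ψ (x 0)) - (f xstar + ψ xstar))
          / ((α - 1) * H 0))
        * (2 * α * Hmax (H 0) Lp / ((Nat.factorial p : ℝ) * εg)) ^ (((p : ℝ) + 1) / (p : ℝ))
      ≤ ((K : ℝ) - (Ubar α (H 0) Lp : ℝ))) :
    ∃ k ≤ K,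
      (∃ u : EuclideanSpace ℝ (Fin n),
        (∀ z ∈ domψ, ψ (x k) + ⟪u, z - x k⟫ ≤ ψ z) ∧ ‖gradient f (x k) + u‖ ≤ εg) ∧
      ((domψ = Set.univ ∧ (∀ z, ψ z = 0) ∧ 2 ≤ p ∧
          (2 * (Nat.factorial (p + 1) : ℝ) * ((f (x 0) + ψ (x 0)) - (f xstar + ψ xstar))
              / ((α - 1) * H 0))
            * (2 * α * Hmax (H 0) Lp / ((Nat.factorial (p - 1) : ℝ) * εH))
              ^ (((p : ℝ) + 1) / ((p : ℝ) - 1))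
          ≤ ((K : ℝ) - (Ubar α (H 0) Lp : ℝ))) →
        ∀ h : EuclideanSpace ℝ (Fin n),
          -(εH * ‖h‖ ^ 2) ≤ iteratedFDeriv ℝ 2 f (x k) (fun _ => h)) := by
  classical
  obtain ⟨q, rfl⟩ : ∃ q, p = q + 1 := ⟨p - 1, by omega⟩
  have hLp : 0 ≤ Lp := by
    have h := (norm_nonneg _).trans (hLip (d 1) 0)
    rw [sub_zero] at h
    exact nonneg_of_mul_nonneg_left h (norm_pos_iff.2 (hdne 1 le_rfl))
  have hfac : (0 : ℝ) < ((q + 1 + 1).factorial : ℝ) := by positivity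
  have hdpos : ∀ k, 1 ≤ k → 0 < ‖d k‖ := fun k hk => norm_pos_iff.2 (hdne k hk)
  have hHeq : ∀ k, 1 ≤ k → f (x (k - 1) + d k) - taylorSum (q + 1) f (x (k - 1)) (d k)
      = H k / ((q + 1 + 1).factorial : ℝ) * ‖d k‖ ^ (q + 1 + 1) := by
    intro k hk
    have := hdpos k hk
    rw [hHk k hk, taylorPoly_eq_taylorSum, add_sub_cancel_left]
    field_simp
  have hHle : ∀ k, H k ≤ Hmax (H 0) Lp := by
    intro k
    rcases Nat.eq_zero_or_pos k with rfl | hk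
    · exact le_max_left _ _
    · refine le_max_of_le_right ?_
      have hpos : 0 < ‖d k‖ ^ (q + 1 + 1) := pow_pos (hdpos k hk) _
      have h := (le_abs_self _).trans (norm_sub_taylorSum_le hf hLip (x (k - 1)) (d k))
      rw [hHeq k hk, mul_le_mul_iff_left₀ hpos, div_le_div_iff_of_pos_right hfac] at h
      exact h
  have hMle : ∀ k, M k ≤ Hmax (H 0) Lp := by
    intro k
    induction k with
    | zero => exact hM0 ▸ hHle 0
    | succ k ih =>
      rw [hM (k + 1) (by omega)]
      exact max_le ih (hHle k)
  have hMge : ∀ k, H 0 ≤ M k := by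
    intro k
    induction k with
    | zero => exact hM0.ge
    | succ k ih =>
      rw [hM (k + 1) (by omega)]
      exact le_max_of_le_left ih
  have hHmax : 0 < Hmax (H 0) Lp := hH0.trans_le (hHle 0)
  have hxmem : ∀ k, x k ∈ domψ := by
    intro k
    induction k with
    | zero => exact hx0
    | succ k ih =>
      rw [hxk (k + 1) (by omega)]
      split_ifs
      · exact hdmem (k + 1) (by omega)
      · exact ih
  have hdescent : ∀ k, 1 ≤ k → f (x (k - 1) + d k) + ψ (x (k - 1) + d k)
      + (α * M k - H k) / ((q + 1 + 1).factorial : ℝ) * ‖d k‖ ^ (q + 1 + 1)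
      ≤ f (x (k - 1)) + ψ (x (k - 1)) := by
    intro k hk
    have h := hdmin k hk _ (hxmem (k - 1))
    rw [omegaReg_self, omegaReg_eq, add_sub_cancel_left] at h
    have h' := hHeq k hk
    rw [sub_div, sub_mul]
    linarith
  set c : ℝ := (α - 1) * H 0 / (2 * ((q + 1 + 1).factorial : ℝ)) with hc
  have hα0 : 0 < α - 1 := sub_pos.2 hα
  have hcpos : 0 < c := by positivity
  have hsucc : ∀ k, 1 ≤ k → 2 * H k ≤ (α + 1) * M k →
      f (x (k - 1) + d k) + ψ (x (k - 1) + d k) + c * ‖d k‖ ^ (q + 1 + 1)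
        ≤ f (x (k - 1)) + ψ (x (k - 1)) := by
    intro k hk hs
    refine le_trans ?_ (hdescent k hk)
    have : c ≤ (α * M k - H k) / ((q + 1 + 1).factorial : ℝ) := by
      rw [hc, ← div_div, div_le_div_iff_of_pos_right hfac]
      nlinarith [hMge k]
    gcongr
  have hxs : ∀ k, 1 ≤ k → 2 * H k ≤ (α + 1) * M k → x k = x (k - 1) + d k := by
    intro k hk hs
    rw [hxk k hk, if_pos]
    have := hsucc k hk hs
    have : 0 ≤ c * ‖d k‖ ^ (q + 1 + 1) := by positivity
    linarith
  have hsum : ∀ N, ∑ k ∈ (Finset.Icc 1 N).filter (fun k => 2 * H k ≤ (α + 1) * M k),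
      c * ‖d k‖ ^ (q + 1 + 1) ≤ (f (x 0) + ψ (x 0)) - (f (x N) + ψ (x N)) := by
    refine sum_filter_le_sub_of_antitone_steps (F := fun k => f (x k) + ψ (x k)) (fun k => ?_)
      (fun k hs => ?_)
    · have h := hxk (k + 1) (by omega)
      split_ifs at h with hle
      · simpa only [h, Nat.add_sub_cancel] using hle
      · simp only [h, Nat.add_sub_cancel, le_refl]
    · have h := hsucc (k + 1) (by omega) hs
      rw [← hxs (k + 1) (by omega) hs] at h
      exact h
  have hcard : ∀ N : ℕ, (N : ℝ) - (Ubar α (H 0) Lp : ℝ)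
      ≤ (((Finset.Icc 1 N).filter (fun k => 2 * H k ≤ (α + 1) * M k)).card : ℝ) := by
    intro N
    have hβ : 1 < (α + 1) / 2 := by linarith
    have h := (mul_pow_card_le_of_running_max hα hM0 hM N).trans (hMle (N + 1))
    have htot := Finset.card_filter_add_card_filter_not (s := Finset.Icc 1 N)
      (fun k => 2 * H k ≤ (α + 1) * M k)
    rw [Nat.card_Icc, Nat.add_sub_cancel] at htot
    have hlog := Real.logb_le_logb_of_le hβ (by positivity) ((le_div_iff₀' hH0).2 h)
    rw [← Real.rpow_natCast, Real.logb_rpow (by linarith) hβ.ne'] at hlog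
    have hU : Real.logb ((α + 1) / 2) (Hmax (H 0) Lp / H 0) ≤ (Ubar α (H 0) Lp : ℝ) :=
      Int.le_ceil _
    have htot' : (N : ℝ) = _ := congrArg (Nat.cast (R := ℝ)) htot.symm
    push_cast at htot'
    linarith
  set S := (Finset.Icc 1 K).filter (fun k => 2 * H k ≤ (α + 1) * M k) with hS
  have hmemS : ∀ N, ∀ k ∈ (Finset.Icc 1 N).filter (fun k => 2 * H k ≤ (α + 1) * M k),
      1 ≤ k ∧ k ≤ N ∧ 2 * H k ≤ (α + 1) * M k := by
    intro N k hk
    rw [Finset.mem_filter, Finset.mem_Icc] at hk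
    exact ⟨hk.1.1, hk.1.2, hk.2⟩
  have hgap : 0 < (f (x 0) + ψ (x 0)) - (f xstar + ψ xstar) := by
    set N := (Ubar α (H 0) Lp).toNat + 1 with hN
    have hNpos : (0 : ℝ) < (N : ℝ) - (Ubar α (H 0) Lp : ℝ) := by
      have : ((Ubar α (H 0) Lp : ℤ) : ℝ) ≤ ((Ubar α (H 0) Lp).toNat : ℝ) := by
        exact_mod_cast Int.self_le_toNat _
      rw [hN]
      push_cast
      linarith
    have hne : ((Finset.Icc 1 N).filter (fun k => 2 * H k ≤ (α + 1) * M k)).Nonempty := by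
      rw [← Finset.card_pos]
      exact_mod_cast hNpos.trans_le (hcard N)
    have hpos := Finset.sum_pos (f := fun k => c * ‖d k‖ ^ (q + 1 + 1))
      (fun k hk => mul_pos hcpos (pow_pos (hdpos k (hmemS N k hk).1) _)) hne
    linarith [hsum N, hminF _ (hxmem N)]
  have hΔ : 2 * ((q + 1 + 1).factorial : ℝ) * ((f (x 0) + ψ (x 0)) - (f xstar + ψ xstar))
      / ((α - 1) * H 0) = ((f (x 0) + ψ (x 0)) - (f xstar + ψ xstar)) / c := by
    rw [hc]
    field_simp
  rw [hΔ] at hK ⊢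
  set Δ := ((f (x 0) + ψ (x 0)) - (f xstar + ψ xstar)) / c with hΔdef
  have hΔpos : 0 < Δ := div_pos hgap hcpos
  have hKS := hK.trans (hcard K)
  have hSpos : 0 < (S.card : ℝ) := lt_of_lt_of_le (by positivity) hKS
  have hSne : S.Nonempty := by
    rw [← Finset.card_pos]
    exact_mod_cast hSpos
  obtain ⟨k, hkS, hkmin⟩ := Finset.exists_min_image S (fun k => ‖d k‖) hSne
  obtain ⟨hk1, hkK, hks⟩ := hmemS K k hkS
  have hbudget : (S.card : ℝ) * ‖d k‖ ^ (q + 1 + 1) ≤ Δ := by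
    have h1 : S.card • (c * ‖d k‖ ^ (q + 1 + 1)) ≤ ∑ j ∈ S, c * ‖d j‖ ^ (q + 1 + 1) :=
      Finset.card_nsmul_le_sum _ _ _ fun j hj => by
        have := hkmin j hj
        gcongr
    rw [nsmul_eq_mul] at h1
    rw [hΔdef, le_div_iff₀ hcpos]
    linarith [hsum K, hminF _ (hxmem K)]
  have hrate : ∀ {C s : ℝ} {m : ℕ}, 0 < m → 0 < C → s = ((q + 1 + 1 : ℕ) : ℝ) / m →
      Δ * C ^ s ≤ (S.card : ℝ) → ‖d k‖ ^ m * C ≤ 1 := by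
    intro C s m hm hC hs h
    refine pow_mul_le_one_of_rpow hm (hdpos k hk1) hC (N := q + 1 + 1) (by omega) hs ?_
    have hCs : 0 < C ^ s := Real.rpow_pos_of_pos hC s
    have h1 := (mul_le_mul_of_nonneg_right hbudget hCs.le).trans h
    rw [mul_assoc] at h1
    exact (mul_le_iff_le_one_right hSpos).1 h1
  have hsmall : ∀ {m : ℕ} {ε : ℝ}, 0 < ε →
      ‖d k‖ ^ m * (2 * α * Hmax (H 0) Lp / ((m.factorial : ℝ) * ε)) ≤ 1 →
      (Lp + α * M k) / (m.factorial : ℝ) * ‖d k‖ ^ m ≤ ε := by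
    intro m ε hε h
    have h1 : Lp + α * M k ≤ 2 * α * Hmax (H 0) Lp := by
      have h2 : Lp ≤ Hmax (H 0) Lp := le_max_right _ _
      nlinarith [hMle k]
    have hm : (0 : ℝ) < m.factorial := by positivity
    rw [mul_div_assoc', div_le_one (by positivity)] at h
    rw [div_mul_eq_mul_div, div_le_iff₀ hm]
    have := mul_le_mul_of_nonneg_right h1 (pow_nonneg (norm_nonneg (d k)) m)
    linarith
  have hσ : 0 ≤ α * M k := mul_nonneg (by linarith) (hH0.le.trans (hMge k))
  refine ⟨k, hkK, ?_, ?_⟩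
  · obtain ⟨u, hu, hun⟩ := exists_subgradient_of_regularized_step hf hLip hσ hψconv
      (hdne k hk1) (hdmem k hk1) (hdmin k hk1)
    rw [hxs k hk1 hks]
    refine ⟨u, hu, hun.trans (hsmall hεg (hrate (by omega) (by positivity) ?_ hKS))⟩
    push_cast
    rfl
  · rintro ⟨hdom, hψ0, hq, hK2⟩ h
    obtain ⟨m, rfl⟩ : ∃ m, q = m + 1 := ⟨q - 1, by omega⟩
    rw [Nat.add_sub_cancel] at hK2
    have hd2 := hsmall hεH (hrate (by omega) (by positivity) (by push_cast; ring)
      (hK2.trans (hcard K)))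
    rw [hxs k hk1 hks]
    refine le_trans (neg_le_neg ?_) (neg_le_second_deriv_of_regularized_step hf hLip hσ
      (hdne k hk1) (fun z => by simpa [hψ0] using hdmin k hk1 z (hdom ▸ Set.mem_univ z)) h)
    gcongr
end
end

section
/- Consider the HAR-C method with budget B satisfying B ≥ Ū + 1, where Ū = ⌈log_{(α+1)/2}(H_max/H_0)⌉ and H_max = max{H_0, L_p}. Then for every k ≥ 1, the number of unsuccessful iterations among the first k satisfies |U ∩ {1, …, k}| ≤ ⌈k/B⌉ · Ū. -/
open scoped BigOperators RealInnerProductSpace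

noncomputable section

/-- One-sided Taylor bound on `[0, ∞)` for a chain `g 0, …, g p` of successive derivatives whose
last member grows at most linearly. -/
lemma le_taylor_sum_of_linear_growth (p : ℕ) (C : ℝ) :
    ∀ g : ℕ → ℝ → ℝ, (∀ j < p, ∀ t, HasDerivAt (g j) (g (j + 1) t) t) →
      (∀ t, 0 ≤ t → g p t ≤ g p 0 + C * t) → ∀ t, 0 ≤ t →
      g 0 t ≤ ∑ ℓ ∈ Finset.range (p + 1), g ℓ 0 * (t ^ ℓ / (ℓ.factorial : ℝ))
        + C * (t ^ (p + 1) / ((p + 1).factorial : ℝ)) := by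
  have hpow : ∀ (ℓ : ℕ) (t : ℝ), HasDerivAt (fun t : ℝ => t ^ (ℓ + 1) / ((ℓ + 1).factorial : ℝ))
      (t ^ ℓ / (ℓ.factorial : ℝ)) t := by
    intro ℓ t
    refine ((hasDerivAt_pow (ℓ + 1) t).div_const ((ℓ + 1).factorial : ℝ)).congr_deriv ?_
    have : (ℓ.factorial : ℝ) ≠ 0 := by positivity
    rw [Nat.factorial_succ, Nat.add_sub_cancel]
    push_cast
    field_simp
  induction p with
  | zero => intro g _ hlin t ht; simpa using hlin t ht
  | succ p ih =>
    intro g hg hlin t ht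
    have hbound := ih (fun j => g (j + 1)) (fun j hj => hg (j + 1) (by omega)) hlin
    have hder : ∀ t, HasDerivAt
        (fun t => g 0 0 + ∑ ℓ ∈ Finset.range (p + 1),
            g (ℓ + 1) 0 * (t ^ (ℓ + 1) / ((ℓ + 1).factorial : ℝ))
          + C * (t ^ (p + 1 + 1) / ((p + 1 + 1).factorial : ℝ)) - g 0 t)
        (∑ ℓ ∈ Finset.range (p + 1), g (ℓ + 1) 0 * (t ^ ℓ / (ℓ.factorial : ℝ))
          + C * (t ^ (p + 1) / ((p + 1).factorial : ℝ)) - g 1 t) t := fun t =>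
      (((HasDerivAt.fun_sum fun ℓ _ => (hpow ℓ t).const_mul (g (ℓ + 1) 0)).const_add _).add
        ((hpow (p + 1) t).const_mul C)).sub (hg 0 (by omega) t)
    have hmono := monotoneOn_of_deriv_nonneg (convex_Ici (0 : ℝ))
      (fun t _ => (hder t).continuousAt.continuousWithinAt)
      (fun t _ => (hder t).differentiableAt.differentiableWithinAt)
      (fun t ht => by
        rw [interior_Ici, Set.mem_Ioi] at ht
        rw [(hder t).deriv]
        exact sub_nonneg.2 (hbound t ht.le))
    have h := hmono (Set.mem_Ici.2 le_rfl) (Set.mem_Ici.2 ht) ht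
    rw [Finset.sum_range_succ']
    simp at h ⊢
    linarith

/-- A function with `Lp`-Lipschitz `p`-th derivative exceeds its Taylor polynomial by at most
`Lp / (p + 1)! * ‖d‖ ^ (p + 1)`. -/
lemma sub_taylorPoly_le {n : ℕ} {p : ℕ} {f : EuclideanSpace ℝ (Fin n) → ℝ} {Lp : ℝ}
    (hf : ContDiff ℝ p f)
    (hLip : ∀ x y : EuclideanSpace ℝ (Fin n),
      ‖iteratedFDeriv ℝ p f x - iteratedFDeriv ℝ p f y‖ ≤ Lp * ‖x - y‖)
    (x d : EuclideanSpace ℝ (Fin n)) :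
    f (x + d) - taylorPoly p f x (x + d) ≤ Lp / ((p + 1).factorial : ℝ) * ‖d‖ ^ (p + 1) := by
  have hline : ∀ t : ℝ, HasDerivAt (fun t : ℝ => x + t • d) d t := fun t => by
    simpa using ((hasDerivAt_id t).smul_const d).const_add x
  have h := le_taylor_sum_of_linear_growth p (Lp * ‖d‖ ^ (p + 1))
    (fun j t => iteratedFDeriv ℝ j f (x + t • d) (fun _ => d))
    (by
      intro j hj t
      have hdiff : DifferentiableAt ℝ (iteratedFDeriv ℝ j f) (x + t • d) :=
        (hf.differentiable_iteratedFDeriv (by exact_mod_cast hj)) _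
      have h1 := hdiff.hasFDerivAt.comp_hasDerivAt t (hline t)
      exact ((ContinuousMultilinearMap.apply ℝ (fun _ : Fin j => EuclideanSpace ℝ (Fin n)) ℝ
        (fun _ => d)).hasFDerivAt.comp_hasDerivAt t h1))
    (by
      intro t ht
      have h1 := (iteratedFDeriv ℝ p f (x + t • d) - iteratedFDeriv ℝ p f x).le_opNorm (fun _ => d)
      have h2 := hLip (x + t • d) x
      rw [add_sub_cancel_left, norm_smul, Real.norm_of_nonneg ht] at h2
      rw [Finset.prod_const, Finset.card_univ, Fintype.card_fin] at h1
      have h3 := h1.trans (mul_le_mul_of_nonneg_right h2 (by positivity))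
      have h4 := (Real.le_norm_self _).trans h3
      rw [sub_apply] at h4
      simp only [zero_smul, add_zero]
      rw [pow_succ]
      linarith)
    1 zero_le_one
  have hT : taylorPoly p f x (x + d) = ∑ ℓ ∈ Finset.range (p + 1),
      iteratedFDeriv ℝ ℓ f x (fun _ => d) * (1 / (ℓ.factorial : ℝ)) := by
    rw [taylorPoly, Finset.range_eq_Ico, Finset.sum_eq_sum_Ico_succ_bot p.succ_pos,
      ← Finset.Ico_add_one_right_eq_Icc]
    simp [mul_comm]
  simp only [one_pow, one_smul, zero_smul, add_zero, iteratedFDeriv_zero_apply] at h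
  rw [hT, sub_le_iff_le_add']
  calc _ ≤ _ := h
    _ = _ := by ring

/-- Counting bound for a regularization sequence that is reset every `B` steps, when an
unsuccessful step multiplies it by more than `q` and it never exceeds `H 0 * q ^ U`. -/
lemma unsuccessful_card_le {q : ℝ} (hq : 1 < q) {H M : ℕ → ℝ} {B U : ℕ}
    (hH0 : 0 < H 0) (hM0 : M 0 = H 0)
    (hM : ∀ k, 1 ≤ k →
      M k = if k % B = 0 then max (H 0) (H (k - 1)) else max (M (k - 1)) (H (k - 1)))
    (hH : ∀ k, 1 ≤ k → H k ≤ H 0 * q ^ U) (k : ℕ) :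
    ((Finset.Icc 1 (k + 1)).filter fun j => q * M j < H j).card ≤ (k / B + 1) * U := by
  classical
  set c : ℕ → ℕ := fun k => ((Finset.Icc 1 k).filter fun j => q * M j < H j).card with hc
  have hcs : ∀ k, c (k + 1) = c k + if q * M (k + 1) < H (k + 1) then 1 else 0 := by
    intro k
    simp only [hc]
    rw [← Finset.insert_Icc_right_eq_Icc_add_one (by omega), Finset.filter_insert]
    split_ifs
    · rw [Finset.card_insert_of_notMem (by simp)]
    · rfl
  have hstep : ∀ k s, 1 ≤ k → H 0 * q ^ s ≤ M k → q * M k < H k →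
      s + 1 < U ∧ H 0 * q ^ (s + 1) ≤ H k := by
    intro k s hk hs hu
    have h1 : H 0 * q ^ (s + 1) < H k := by
      rw [pow_succ]; nlinarith
    exact ⟨(pow_lt_pow_iff_right₀ hq).1 (lt_of_mul_lt_mul_left (h1.trans_le (hH k hk)) hH0.le),
      h1.le⟩
  have hinv : ∀ k, ∃ s ≤ U - 1, c k ≤ k / B * (U - 1) + s ∧ H 0 * q ^ s ≤ max (M k) (H k) := by
    intro k
    induction k with
    | zero => exact ⟨0, by simp [hc]⟩
    | succ k ih =>
      obtain ⟨s, hsU, hcs', hs⟩ := ih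
      obtain ⟨s', hsU', hc', hs'⟩ : ∃ s ≤ U - 1, c k ≤ (k + 1) / B * (U - 1) + s ∧
          H 0 * q ^ s ≤ M (k + 1) := by
        have hMk := hM (k + 1) (by omega)
        rw [Nat.add_sub_cancel] at hMk
        have hdiv := Nat.succ_div (a := k) (b := B)
        by_cases hB : (k + 1) % B = 0
        · rw [if_pos hB] at hMk
          rw [if_pos (Nat.dvd_of_mod_eq_zero hB)] at hdiv
          refine ⟨0, by omega, ?_, by simp [hMk]⟩
          rw [hdiv, add_mul]; omega
        · rw [if_neg hB] at hMk
          exact ⟨s, hsU, hcs'.trans (by gcongr; omega), hMk ▸ hs⟩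
      by_cases hu : q * M (k + 1) < H (k + 1)
      · obtain ⟨h1, h2⟩ := hstep (k + 1) s' (by omega) hs' hu
        refine ⟨s' + 1, by omega, ?_, h2.trans (le_max_right _ _)⟩
        rw [hcs, if_pos hu]; omega
      · refine ⟨s', hsU', ?_, hs'.trans (le_max_left _ _)⟩
        rw [hcs, if_neg hu]; omega
  have hge : ∀ k, 1 ≤ k → H 0 ≤ M k := by
    intro k hk
    induction k, hk using Nat.le_induction with
    | base => rw [hM 1 le_rfl]; split_ifs <;> simp [hM0]
    | succ k hk ih =>
      rw [hM (k + 1) (by omega)]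
      split_ifs
      · exact le_max_left _ _
      · exact ih.trans (le_max_left _ _)
  obtain ⟨s, hsU, hck, -⟩ := hinv k
  change c (k + 1) ≤ _
  have hmono : (k / B + 1) * (U - 1) ≤ (k / B + 1) * U := by gcongr; omega
  have hsum : (k / B + 1) * (U - 1) = k / B * (U - 1) + (U - 1) := by ring
  rw [hcs]
  split_ifs with hu
  · obtain ⟨h1, -⟩ := hstep (k + 1) 0 (by omega) (by simpa using hge (k + 1) (by omega)) hu
    have h2 : (k / B + 1) * (U - 1) + 1 ≤ (k / B + 1) * U := by
      obtain ⟨V, rfl⟩ : ∃ V, U = V + 1 := ⟨U - 1, by omega⟩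
      rw [Nat.add_sub_cancel, mul_add_one]
      exact Nat.add_le_add_left (Nat.le_add_left 1 _) _
    omega
  · omega

theorem HARC_unsuccessful_count
    {n : ℕ} (p : ℕ) (hp : 1 ≤ p)
    (f : EuclideanSpace ℝ (Fin n) → ℝ) (Lp : ℝ)
    (hf : ContDiff ℝ p f)
    (hLip : ∀ x y : EuclideanSpace ℝ (Fin n),
      ‖iteratedFDeriv ℝ p f x - iteratedFDeriv ℝ p f y‖ ≤ Lp * ‖x - y‖)
    (domψ : Set (EuclideanSpace ℝ (Fin n))) (ψ : EuclideanSpace ℝ (Fin n) → ℝ)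
    (hdom_ne : domψ.Nonempty) (hdom_closed : IsClosed domψ) (hdom_conv : Convex ℝ domψ)
    (hψconv : ConvexOn ℝ domψ ψ) (hψlsc : LowerSemicontinuousOn ψ domψ)
    (xstar : EuclideanSpace ℝ (Fin n)) (hstar : xstar ∈ domψ)
    (hminF : ∀ z ∈ domψ, f xstar + ψ xstar ≤ f z + ψ z)
    (α : ℝ) (hα : 1 < α)
    (x d : ℕ → EuclideanSpace ℝ (Fin n)) (H M : ℕ → ℝ)
    (hx0 : x 0 ∈ domψ) (hH0 : 0 < H 0) (hM0 : M 0 = H 0)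
    (B : ℕ) (hB : Ubar α (H 0) Lp + 1 ≤ (B : ℤ))
    (hM : ∀ k, 1 ≤ k →
      M k = if k % B = 0 then max (H 0) (H (k - 1)) else max (M (k - 1)) (H (k - 1)))
    (hdmem : ∀ k, 1 ≤ k → x (k - 1) + d k ∈ domψ)
    (hdmin : ∀ k, 1 ≤ k → ∀ z ∈ domψ,
      omegaReg p (α * M k) f (x (k - 1)) (x (k - 1) + d k) + ψ (x (k - 1) + d k)
        ≤ omegaReg p (α * M k) f (x (k - 1)) z + ψ z)
    (hdne : ∀ k, 1 ≤ k → d k ≠ 0)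
    (hxk : ∀ k, 1 ≤ k →
      x k = if f (x (k - 1) + d k) + ψ (x (k - 1) + d k) ≤ f (x (k - 1)) + ψ (x (k - 1))
            then x (k - 1) + d k else x (k - 1))
    (hHk : ∀ k, 1 ≤ k → H k / (Nat.factorial (p + 1) : ℝ)
      = (f (x (k - 1) + d k) - taylorPoly p f (x (k - 1)) (x (k - 1) + d k)) / ‖d k‖ ^ (p + 1)) :
    ∀ k : ℕ, 1 ≤ k →
      (({j : ℕ | 1 ≤ j ∧ (α + 1) * M j < 2 * H j} ∩ Set.Icc 1 k).ncard : ℤ)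
        ≤ ⌈(k : ℝ) / (B : ℝ)⌉ * Ubar α (H 0) Lp := by
  have hq : 1 < (α + 1) / 2 := by linarith
  have hratio : 1 ≤ Hmax (H 0) Lp / H 0 := (one_le_div hH0).2 (le_max_left _ _)
  obtain ⟨U, hU⟩ : ∃ U : ℕ, Ubar α (H 0) Lp = U :=
    Int.eq_ofNat_of_zero_le (Int.ceil_nonneg (Real.logb_nonneg hq hratio))
  have hmax : Hmax (H 0) Lp ≤ H 0 * ((α + 1) / 2) ^ U := by
    have h1 : Real.logb ((α + 1) / 2) (Hmax (H 0) Lp / H 0) ≤ (U : ℝ) := by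
      exact_mod_cast Int.ceil_le.1 (show Ubar α (H 0) Lp ≤ (U : ℤ) from hU.le)
    rw [Real.logb_le_iff_le_rpow hq (by linarith), Real.rpow_natCast, div_le_iff₀ hH0] at h1
    linarith
  have hHle : ∀ k, 1 ≤ k → H k ≤ H 0 * ((α + 1) / 2) ^ U := by
    intro k hk
    refine le_trans ?_ ((le_max_right (H 0) Lp).trans hmax)
    have hd : 0 < ‖d k‖ ^ (p + 1) := pow_pos (norm_pos_iff.2 (hdne k hk)) _
    have h := (div_le_iff₀ hd).2 (sub_taylorPoly_le hf hLip (x (k - 1)) (d k))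
    rw [← hHk k hk] at h
    exact (div_le_div_iff_of_pos_right (by positivity)).1 h
  intro k hk
  obtain ⟨m, rfl⟩ : ∃ m, k = m + 1 := ⟨k - 1, by omega⟩
  have hset : {j : ℕ | 1 ≤ j ∧ (α + 1) * M j < 2 * H j} ∩ Set.Icc 1 (m + 1)
      = ((Finset.Icc 1 (m + 1)).filter fun j => (α + 1) / 2 * M j < H j : Finset ℕ) := by
    ext j
    have : (α + 1) * M j < 2 * H j ↔ (α + 1) / 2 * M j < H j := by
      constructor <;> intro <;> linarith
    simp [this]
    tauto
  have hBpos : 0 < B := by omega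
  have hceil : ((m / B + 1 : ℕ) : ℤ) ≤ ⌈((m + 1 : ℕ) : ℝ) / (B : ℝ)⌉ := by
    have hBR : (0 : ℝ) < B := by exact_mod_cast hBpos
    have h1 : ((m / B : ℕ) : ℝ) * B ≤ m := by exact_mod_cast Nat.div_mul_le_self m B
    have h2 : ((m / B : ℕ) : ℤ) < ⌈((m + 1 : ℕ) : ℝ) / (B : ℝ)⌉ := by
      rw [Int.lt_ceil, lt_div_iff₀ hBR, Int.cast_natCast, Nat.cast_succ]
      linarith
    push_cast at h2 ⊢
    omega
  rw [hset, Set.ncard_coe_finset, hU]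
  calc _ ≤ (((m / B + 1) * U : ℕ) : ℤ) := by
        exact_mod_cast unsuccessful_card_le hq hH0 hM0 hM hHle m
    _ ≤ _ := by
        rw [Nat.cast_mul]
        exact mul_le_mul_of_nonneg_right hceil (Int.natCast_nonneg U)
end
end
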